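/- arXiv:1710.10718 — 8 statements merged into one kernel-verified Lean document; each statement's English description precedes it below -/
import Mathlib

section
/- Let P_1, …, P_m be a sequence of nonempty feasible packets such that, setting E_1 = 𝒲 and E_{i+1} = E_i \ P_i for 1 ≤ i ≤ m, one has: (i) P_i ⊆ E_i for each i; (ii) for each i and every nonempty feasible packet P with P ⊆ E_i, |P| / b(P) ≤ |P_i| / b(P_i) (i.e. P_i maximizes the ratio of cardinality to size among nonempty feasible packets contained in the uncovered remainder E_i); and (iii) E_{m+1} = ∅. Then the total cost satisfies Σ_{i=1}^m b(P_i) ≤ (1 + log K) · OPT(𝒲), where log denotes the natural logarithm. -/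
open Finset

variable {α : Type*}

/-- A finite set of subfiles is a feasible packet (clique) if for any two distinct
subfiles `(k,A)`, `(l,B)` in it one has `k ≠ l`, `k ∈ B`, and `l ∈ A`. -/
def Feasible (P : Finset (α × Finset α)) : Prop :=
  ∀ p ∈ P, ∀ q ∈ P, p ≠ q → p.1 ≠ q.1 ∧ p.1 ∈ q.2 ∧ q.1 ∈ p.2

/-- Size of a packet: the maximum of the sizes of the subfiles in it
(`0` for the empty packet). -/
noncomputable def psize (b : α × Finset α → ℝ) (P : Finset (α × Finset α)) : ℝ :=
  sSup (b '' ↑P)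

/-- A clique cover of `Ws`: a finite family of nonempty feasible packets, each contained
in `Ws`, whose union is `Ws`. -/
def IsCover [DecidableEq α] (Ws : Finset (α × Finset α))
    (C : Finset (Finset (α × Finset α))) : Prop :=
  (∀ P ∈ C, P.Nonempty ∧ Feasible P ∧ P ⊆ Ws) ∧ C.biUnion id = Ws

/-- Cost of a family of packets: the sum of their sizes. -/
noncomputable def cost (b : α × Finset α → ℝ) (C : Finset (Finset (α × Finset α))) : ℝ :=
  ∑ P ∈ C, psize b P

/-- Minimum cost of a clique cover of `Ws`. -/
noncomputable def OPT [DecidableEq α] (b : α × Finset α → ℝ)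
    (Ws : Finset (α × Finset α)) : ℝ :=
  sInf {c : ℝ | ∃ C, IsCover Ws C ∧ c = cost b C}

lemma psize_mono (b : α × Finset α → ℝ) {Q R : Finset (α × Finset α)} (hQ : Q.Nonempty)
    (h : Q ⊆ R) : psize b Q ≤ psize b R := by
  unfold psize
  apply csSup_le_csSup
  · exact (R.finite_toSet.image b).bddAbove
  · exact (Finset.coe_nonempty.mpr hQ).image b
  · exact Set.image_mono (Finset.coe_subset.mpr h)

lemma psize_pos (b : α × Finset α → ℝ) {Q : Finset (α × Finset α)} (hQ : Q.Nonempty)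
    (h : ∀ W ∈ Q, 0 < b W) : 0 < psize b Q := by
  obtain ⟨w, hw⟩ := hQ
  refine lt_of_lt_of_le (h w hw) ?_
  exact le_csSup (Q.finite_toSet.image b).bddAbove ⟨w, hw, rfl⟩

lemma harm_step (N a d : ℕ) (h : a + d ≤ N) (hN : 0 < N) :
    (d : ℝ) / N ≤ (harmonic (a + d) : ℝ) - (harmonic a : ℝ) := by
  induction d with
  | zero => simp
  | succ d ih =>
    have ih' := ih (by omega)
    rw [← add_assoc, harmonic_succ]
    push_cast
    have h1 : (1 : ℝ) / N ≤ ((a : ℝ) + d + 1)⁻¹ := by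
      rw [one_div]
      apply inv_anti₀
      · positivity
      · exact_mod_cast h
    rw [add_div]
    linarith

lemma harmonic_le_bound {n K : ℕ} (hK : 1 ≤ K) (h : n ≤ K) :
    (harmonic n : ℝ) ≤ 1 + Real.log K := by
  have h1 := harm_step K n (K - n) (by omega) (by omega)
  rw [Nat.add_sub_cancel' h] at h1
  have h2 : (0 : ℝ) ≤ ((K - n : ℕ) : ℝ) / K := by positivity
  have h3 := harmonic_le_one_add_log K
  linarith

lemma feasible_card {K : ℕ} {Q : Finset (Fin K × Finset (Fin K))} (h : Feasible Q) :
    Q.card ≤ K := by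
  have : Q.card ≤ (Finset.univ : Finset (Fin K)).card := by
    apply Finset.card_le_card_of_injOn Prod.fst (fun _ _ => Finset.mem_coe.mpr (Finset.mem_univ _))
    intro x hx y hy hxy
    by_contra hne
    exact (h x hx y hy hne).1 hxy
  simpa using this

/-- Greedy ratio-maximizing selection of feasible packets yields a
`(1 + log K)`-approximation to the optimal clique cover delivery problem. -/
theorem stmt0 {K : ℕ} (hK : 1 ≤ K) (b : Fin K × Finset (Fin K) → ℝ)
    (hb : ∀ W : Fin K × Finset (Fin K), W.1 ∉ W.2 → 0 < b W)
    (Ws : Finset (Fin K × Finset (Fin K))) (hWs : ∀ W ∈ Ws, W.1 ∉ W.2)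
    (m : ℕ) (P E : ℕ → Finset (Fin K × Finset (Fin K)))
    (hE1 : E 1 = Ws)
    (hEstep : ∀ i ∈ Finset.Icc 1 m, E (i + 1) = E i \ P i)
    (hEnd : E (m + 1) = ∅)
    (hPne : ∀ i ∈ Finset.Icc 1 m, (P i).Nonempty)
    (hPfeas : ∀ i ∈ Finset.Icc 1 m, Feasible (P i))
    (hPsub : ∀ i ∈ Finset.Icc 1 m, P i ⊆ E i)
    (hgreedy : ∀ i ∈ Finset.Icc 1 m, ∀ Q : Finset (Fin K × Finset (Fin K)),
      Q.Nonempty → Feasible Q → Q ⊆ E i →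
      (Q.card : ℝ) / psize b Q ≤ ((P i).card : ℝ) / psize b (P i)) :
    ∑ i ∈ Finset.Icc 1 m, psize b (P i) ≤ (1 + Real.log K) * OPT b Ws := by
  have hlog : 0 ≤ Real.log K := Real.log_natCast_nonneg K
  have hsubW : ∀ j, j ≤ m → E (j + 1) ⊆ Ws := by
    intro j
    induction j with
    | zero => intro _; simp [hE1]
    | succ j ih =>
      intro hj
      rw [hEstep (j + 1) (by simp; omega)]
      exact Finset.sdiff_subset.trans (ih (by omega))
  have hEW : ∀ i ∈ Finset.Icc 1 m, E i ⊆ Ws := by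
    intro i hi
    rw [Finset.mem_Icc] at hi
    have := hsubW (i - 1) (by omega)
    rwa [Nat.sub_add_cancel hi.1] at this
  have hpos : ∀ Q : Finset (Fin K × Finset (Fin K)), Q.Nonempty → Q ⊆ Ws → 0 < psize b Q :=
    fun Q hQ hs => psize_pos b hQ (fun W hW => hb W (hWs W (hs hW)))
  -- per-step bound
  have hstep : ∀ Q : Finset (Fin K × Finset (Fin K)), Q.Nonempty → Feasible Q → Q ⊆ Ws →
      ∀ i ∈ Finset.Icc 1 m, ((Q ∩ P i).card : ℝ) * (psize b (P i) / (P i).card) ≤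
        psize b Q * ((harmonic (Q ∩ E i).card : ℝ) - (harmonic (Q ∩ E (i + 1)).card : ℝ)) := by
    intro Q hQ hF hs i hi
    have hcard : (Q ∩ E (i + 1)).card + (Q ∩ P i).card = (Q ∩ E i).card := by
      rw [hEstep i hi, ← Finset.card_union_of_disjoint]
      · congr 1
        ext x
        have := @hPsub i hi x
        simp only [Finset.mem_union, Finset.mem_inter, Finset.mem_sdiff]
        tauto
      · rw [Finset.disjoint_left]
        intro x
        simp only [Finset.mem_inter, Finset.mem_sdiff]
        tauto
    by_cases hne : (Q ∩ E i).Nonempty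
    · have hn : 0 < (Q ∩ E i).card := hne.card_pos
      have hn' : (0 : ℝ) < (Q ∩ E i).card := by exact_mod_cast hn
      have hg := hgreedy i hi (Q ∩ E i) hne
        (fun p hp q hq => hF p (Finset.mem_inter.mp hp).1 q (Finset.mem_inter.mp hq).1)
        Finset.inter_subset_right
      have hp1 : 0 < psize b (Q ∩ E i) := hpos _ hne (Finset.inter_subset_left.trans hs)
      have hp2 : 0 < psize b (P i) := hpos _ (hPne i hi) ((hPsub i hi).trans (hEW i hi))
      have hp3 : (0 : ℝ) < (P i).card := by exact_mod_cast (hPne i hi).card_pos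
      have hm : psize b (Q ∩ E i) ≤ psize b Q := psize_mono b hne Finset.inter_subset_left
      have hp4 := hpos Q hQ hs
      have hprice : psize b (P i) / (P i).card ≤ psize b Q / (Q ∩ E i).card := by
        rw [div_le_div_iff₀ hp1 hp2] at hg
        rw [div_le_div_iff₀ hp3 hn']
        nlinarith
      have hh := harm_step (Q ∩ E i).card (Q ∩ E (i + 1)).card (Q ∩ P i).card (by omega) hn
      rw [hcard] at hh
      calc ((Q ∩ P i).card : ℝ) * (psize b (P i) / (P i).card)
          ≤ ((Q ∩ P i).card : ℝ) * (psize b Q / (Q ∩ E i).card) := by gcongr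
        _ = psize b Q * (((Q ∩ P i).card : ℝ) / (Q ∩ E i).card) := by ring
        _ ≤ _ := by gcongr
    · have h0 : (Q ∩ E i).card = 0 := by
        rw [Finset.card_eq_zero]; exact Finset.not_nonempty_iff_eq_empty.mp hne
      have h1 : (Q ∩ P i).card = 0 := by omega
      have h2 : (Q ∩ E (i + 1)).card = 0 := by omega
      rw [h0, h1, h2]
      simp
  have hQbound : ∀ Q : Finset (Fin K × Finset (Fin K)), Q.Nonempty → Feasible Q → Q ⊆ Ws →
      ∑ i ∈ Finset.Icc 1 m, ((Q ∩ P i).card : ℝ) * (psize b (P i) / (P i).card) ≤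
        (1 + Real.log K) * psize b Q := by
    intro Q hQ hF hs
    have htel : ∀ j, j ≤ m →
        ∑ i ∈ Finset.Icc 1 j, ((Q ∩ P i).card : ℝ) * (psize b (P i) / (P i).card) ≤
        psize b Q * ((harmonic (Q ∩ E 1).card : ℝ) - (harmonic (Q ∩ E (j + 1)).card : ℝ)) := by
      intro j
      induction j with
      | zero => intro _; simp
      | succ j ih =>
        intro hj
        rw [Finset.sum_Icc_succ_top (by omega)]
        have h1 := ih (by omega)
        have h2 := hstep Q hQ hF hs (j + 1) (by simp; omega)
        linarith
    have h := htel m le_rfl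
    rw [hEnd, hE1, Finset.inter_eq_left.mpr hs] at h
    simp only [Finset.inter_empty, Finset.card_empty, harmonic_zero, Rat.cast_zero, sub_zero] at h
    have hH := harmonic_le_bound hK (feasible_card hF)
    have hp := hpos Q hQ hs
    nlinarith
  have hcover : ∀ C, IsCover Ws C →
      ∑ i ∈ Finset.Icc 1 m, psize b (P i) ≤ (1 + Real.log K) * cost b C := by
    intro C hC
    unfold cost
    rw [Finset.mul_sum]
    refine le_trans ?_ (Finset.sum_le_sum fun Q hQ =>
      hQbound Q (hC.1 Q hQ).1 (hC.1 Q hQ).2.1 (hC.1 Q hQ).2.2)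
    rw [Finset.sum_comm]
    apply Finset.sum_le_sum
    intro i hi
    rw [← Finset.sum_mul]
    have hp2 : 0 < psize b (P i) := hpos _ (hPne i hi) ((hPsub i hi).trans (hEW i hi))
    have hp3 : (0 : ℝ) < (P i).card := by exact_mod_cast (hPne i hi).card_pos
    have hc : (P i).card ≤ ∑ Q ∈ C, (Q ∩ P i).card := by
      refine le_trans (Finset.card_le_card ?_) Finset.card_biUnion_le
      intro x hx
      have hxW : x ∈ C.biUnion id := by
        rw [hC.2]; exact hEW i hi (hPsub i hi hx)
      obtain ⟨Q, hQ, hxQ⟩ := Finset.mem_biUnion.mp hxW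
      exact Finset.mem_biUnion.mpr ⟨Q, hQ, Finset.mem_inter.mpr ⟨hxQ, hx⟩⟩
    have hc' : ((P i).card : ℝ) ≤ ∑ Q ∈ C, ((Q ∩ P i).card : ℝ) := by exact_mod_cast hc
    calc psize b (P i) = ((P i).card : ℝ) * (psize b (P i) / (P i).card) := by field_simp
      _ ≤ _ := by gcongr
  have hpos1 : 0 < 1 + Real.log K := by linarith
  rw [← div_le_iff₀' hpos1]
  unfold OPT
  apply le_csInf
  · refine ⟨_, Ws.image (fun x => {x}), ⟨?_, ?_⟩, rfl⟩
    · intro Q hQ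
      obtain ⟨x, hx, rfl⟩ := Finset.mem_image.mp hQ
      refine ⟨Finset.singleton_nonempty x, ?_, Finset.singleton_subset_iff.mpr hx⟩
      intro p hp q hq hpq
      rw [Finset.mem_singleton] at hp hq
      exact absurd (hp.trans hq.symm) hpq
    · ext ⟨x, y⟩
      simp
  · rintro c ⟨C, hC, rfl⟩
    rw [div_le_iff₀' hpos1]
    exact hcover C hC
end

section
/- Let E be a nonempty subset of 𝒲. Then the maximum over all nonempty feasible packets P ⊆ E of the ratio |P| / b(P) equals the maximum over all admissible nonempty T ⊆ M(E) of the ratio |T| / β_T(E). (Both maxima are over nonempty finite collections: singletons {(k,A)} are feasible packets, and each singleton {k} with k ∈ M(E) is admissible.) -/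
open Finset

variable {α : Type*}

/-- `Mset E`: the set of users having a subfile in `E`. -/
def Mset [DecidableEq α] (E : Finset (α × Finset α)) : Finset α := E.image Prod.fst

/-- `Lset E T j`: the subfiles `(j, A) ∈ E` with `T \ {j} ⊆ A`. -/
def Lset [DecidableEq α] (E : Finset (α × Finset α)) (T : Finset α) (j : α) :
    Finset (α × Finset α) :=
  E.filter fun W => W.1 = j ∧ T.erase j ⊆ W.2

/-- `beta b E T = max_{j ∈ T} min_{W ∈ Lset E T j} b W` (for `T` nonempty and
admissible). -/
noncomputable def beta [DecidableEq α] (b : α × Finset α → ℝ)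
    (E : Finset (α × Finset α)) (T : Finset α) : ℝ :=
  sSup ((fun j => sInf (b '' ↑(Lset E T j))) '' ↑T)

/-- The maximum of `|P| / b(P)` over nonempty feasible packets `P ⊆ E`
equals the maximum of `|T| / β_T(E)` over admissible nonempty `T ⊆ M(E)`. -/
theorem stmt1 {K : ℕ} (hK : 1 ≤ K) (b : Fin K × Finset (Fin K) → ℝ)
    (hb : ∀ W : Fin K × Finset (Fin K), W.1 ∉ W.2 → 0 < b W)
    (Ws : Finset (Fin K × Finset (Fin K))) (hWs : ∀ W ∈ Ws, W.1 ∉ W.2)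
    (E : Finset (Fin K × Finset (Fin K))) (hE : E ⊆ Ws) (hEne : E.Nonempty) :
    sSup {r : ℝ | ∃ P : Finset (Fin K × Finset (Fin K)),
        P.Nonempty ∧ Feasible P ∧ P ⊆ E ∧ r = (P.card : ℝ) / psize b P}
      = sSup {r : ℝ | ∃ T : Finset (Fin K),
        T.Nonempty ∧ T ⊆ Mset E ∧ (∀ j ∈ T, (Lset E T j).Nonempty) ∧
        r = (T.card : ℝ) / beta b E T} := by
  have hpos : ∀ W ∈ E, 0 < b W := fun W hW => hb W (hWs W (hE hW))
  -- the minimum defining `beta` is attained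
  have hmin : ∀ T : Finset (Fin K), ∀ j, (Lset E T j).Nonempty →
      ∃ W ∈ Lset E T j, sInf (b '' ↑(Lset E T j)) = b W := by
    intro T j hne
    have h := Set.Nonempty.csInf_mem (s := b '' ↑(Lset E T j))
      ((Finset.coe_nonempty.2 hne).image b) ((Lset E T j).finite_toSet.image b)
    obtain ⟨W, hW, hWe⟩ := h
    exact ⟨W, hW, hWe.symm⟩
  have hLE : ∀ (T : Finset (Fin K)) (j : Fin K) (W : Fin K × Finset (Fin K)),
      W ∈ Lset E T j ↔ W ∈ E ∧ W.1 = j ∧ T.erase j ⊆ W.2 := by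
    intro T j W
    simp [Lset]
  have hbeta : ∀ T : Finset (Fin K), T.Nonempty → (∀ j ∈ T, (Lset E T j).Nonempty) →
      0 < beta b E T := by
    rintro T ⟨j, hj⟩ hadm
    obtain ⟨W, hW, hWe⟩ := hmin T j (hadm j hj)
    have h1 : sInf (b '' ↑(Lset E T j)) ≤ beta b E T :=
      le_csSup (T.finite_toSet.image _).bddAbove ⟨j, hj, rfl⟩
    have h2 := hpos W ((hLE T j W).1 hW).1
    linarith
  -- from packets to user sets
  have hPT : ∀ P : Finset (Fin K × Finset (Fin K)), P.Nonempty → Feasible P → P ⊆ E →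
      ∃ T : Finset (Fin K), T.Nonempty ∧ T ⊆ Mset E ∧ (∀ j ∈ T, (Lset E T j).Nonempty) ∧
        (P.card : ℝ) / psize b P ≤ (T.card : ℝ) / beta b E T := by
    intro P hne hf hPE
    have hmem : ∀ W ∈ P, W ∈ Lset E (P.image Prod.fst) W.1 := by
      intro W hW
      refine (hLE _ _ _).2 ⟨hPE hW, rfl, ?_⟩
      intro k hk
      obtain ⟨hk1, hk2⟩ := Finset.mem_erase.1 hk
      obtain ⟨V, hV, rfl⟩ := Finset.mem_image.1 hk2
      exact (hf W hW V hV (fun h => hk1 (by rw [h]))).2.2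
    have hadm : ∀ j ∈ P.image Prod.fst, (Lset E (P.image Prod.fst) j).Nonempty := by
      intro j hj
      obtain ⟨V, hV, rfl⟩ := Finset.mem_image.1 hj
      exact ⟨V, hmem V hV⟩
    have hTne : (P.image Prod.fst).Nonempty := hne.image _
    refine ⟨P.image Prod.fst, hTne, Finset.image_subset_image hPE, hadm, ?_⟩
    have hcard : (P.image Prod.fst).card = P.card := by
      apply Finset.card_image_of_injOn
      intro p hp q hq h
      by_contra hpq
      exact (hf p hp q hq hpq).1 h
    rw [hcard]
    refine div_le_div_of_nonneg_left (Nat.cast_nonneg _) (hbeta _ hTne hadm) ?_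
    refine csSup_le ((Finset.coe_nonempty.2 hTne).image _) ?_
    rintro _ ⟨j, hj, rfl⟩
    obtain ⟨V, hV, rfl⟩ := Finset.mem_image.1 (Finset.mem_coe.1 hj)
    exact (csInf_le (Set.Finite.bddBelow ((Finset.finite_toSet _).image b))
      ⟨V, hmem V hV, rfl⟩).trans
      (le_csSup (P.finite_toSet.image b).bddAbove ⟨V, hV, rfl⟩)
  -- from user sets to packets
  have hTP : ∀ T : Finset (Fin K), T.Nonempty → (∀ j ∈ T, (Lset E T j).Nonempty) →
      ∃ P : Finset (Fin K × Finset (Fin K)), P.Nonempty ∧ Feasible P ∧ P ⊆ E ∧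
        (T.card : ℝ) / beta b E T = (P.card : ℝ) / psize b P := by
    intro T hne hadm
    have hex : ∀ j : Fin K, ∃ W, j ∈ T →
        W ∈ Lset E T j ∧ sInf (b '' ↑(Lset E T j)) = b W := by
      intro j
      by_cases hj : j ∈ T
      · obtain ⟨W, hW⟩ := hmin T j (hadm j hj)
        exact ⟨W, fun _ => hW⟩
      · exact ⟨(j, ∅), fun h => absurd h hj⟩
    choose w hw using hex
    have hw1 : ∀ j ∈ T, w j ∈ E ∧ (w j).1 = j ∧ T.erase j ⊆ (w j).2 := fun j hj =>
      (hLE _ _ _).1 (hw j hj).1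
    refine ⟨T.image w, hne.image _, ?_, ?_, ?_⟩
    · intro p hp q hq hpq
      obtain ⟨i, hi, rfl⟩ := Finset.mem_image.1 hp
      obtain ⟨j, hj, rfl⟩ := Finset.mem_image.1 hq
      have hij : i ≠ j := fun h => hpq (by rw [h])
      rw [(hw1 i hi).2.1, (hw1 j hj).2.1]
      exact ⟨hij, (hw1 j hj).2.2 (Finset.mem_erase.2 ⟨hij, hi⟩),
        (hw1 i hi).2.2 (Finset.mem_erase.2 ⟨hij.symm, hj⟩)⟩
    · intro p hp
      obtain ⟨i, hi, rfl⟩ := Finset.mem_image.1 hp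
      exact (hw1 i hi).1
    · have hcard : (T.image w).card = T.card := by
        apply Finset.card_image_of_injOn
        intro i hi j hj h
        rw [← (hw1 i hi).2.1, ← (hw1 j hj).2.1, h]
      have hsz : beta b E T = psize b (T.image w) := by
        unfold beta psize
        rw [Finset.coe_image, Set.image_image]
        congr 1
        exact Set.image_congr (fun j hj => (hw j hj).2)
      rw [hcard, hsz]
  obtain ⟨W0, hW0⟩ := hEne
  have hs : Feasible ({W0} : Finset (Fin K × Finset (Fin K))) := by
    intro p hp q hq hpq
    rw [Finset.mem_singleton] at hp hq
    exact absurd (hp.trans hq.symm) hpq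
  have hsE : ({W0} : Finset (Fin K × Finset (Fin K))) ⊆ E := Finset.singleton_subset_iff.2 hW0
  apply le_antisymm
  · refine csSup_le ⟨_, {W0}, Finset.singleton_nonempty _, hs, hsE, rfl⟩ ?_
    rintro _ ⟨P, hne, hf, hPE, rfl⟩
    obtain ⟨T, h1, h2, h3, h4⟩ := hPT P hne hf hPE
    refine h4.trans (le_csSup ?_ ⟨T, h1, h2, h3, rfl⟩)
    refine ((Set.finite_range
      (fun T : Finset (Fin K) => (T.card : ℝ) / beta b E T)).subset ?_).bddAbove
    rintro _ ⟨T, -, -, -, rfl⟩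
    exact ⟨T, rfl⟩
  · obtain ⟨T0, h1, h2, h3, -⟩ := hPT {W0} (Finset.singleton_nonempty _) hs hsE
    refine csSup_le ⟨_, T0, h1, h2, h3, rfl⟩ ?_
    rintro _ ⟨T, hne, hTM, hadm, rfl⟩
    obtain ⟨P, h1, h2, h3, h4⟩ := hTP T hne hadm
    refine le_csSup ?_ ⟨P, h1, h2, h3, h4⟩
    refine ((Set.finite_range
      (fun P : Finset (Fin K × Finset (Fin K)) => (P.card : ℝ) / psize b P)).subset ?_).bddAbove
    rintro _ ⟨P, -, -, -, rfl⟩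
    exact ⟨P, rfl⟩
end

section
/- Let P_1, …, P_m be a sequence of packets such that, setting E_1 = 𝒲 and E_{i+1} = E_i \ P_i, one has E_{m+1} = ∅ and, for each i: there is a set T_i ⊆ M(E_i) that is admissible for E_i and maximizes |T| / β_T(E_i) over all admissible nonempty T ⊆ M(E_i), and P_i consists of exactly one subfile for each j ∈ T_i, namely an element of L_{j,T_i}(E_i) of minimum size. Then each P_i is a nonempty feasible packet contained in E_i, the family {P_1,…,P_m} is a clique cover of 𝒲, and Σ_{i=1}^m b(P_i) ≤ (1 + log K) · OPT(𝒲), where log denotes the natural logarithm. (This is the guarantee of the Size-Aware Coded Multicast algorithm.) -/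
open Finset

variable {α : Type*}

lemma aux_le_psize {K : ℕ} (b : Fin K × Finset (Fin K) → ℝ) (Q : Finset (Fin K × Finset (Fin K)))
    (W : Fin K × Finset (Fin K)) (hW : W ∈ Q) : b W ≤ psize b Q := by
  unfold psize
  exact le_csSup ((Q.finite_toSet.image b).bddAbove) ⟨W, hW, rfl⟩

lemma aux_le_beta {K : ℕ} (b : Fin K × Finset (Fin K) → ℝ) (E : Finset (Fin K × Finset (Fin K)))
    (T : Finset (Fin K)) (j : Fin K) (hj : j ∈ T) (x : ℝ) (hne : (Lset E T j).Nonempty)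
    (hx : ∀ W ∈ Lset E T j, x ≤ b W) : x ≤ beta b E T := by
  unfold beta
  have h1 : x ≤ sInf (b '' ↑(Lset E T j)) := by
    apply le_csInf
    · exact (Finset.coe_nonempty.mpr hne).image b
    · rintro _ ⟨W, hW, rfl⟩
      exact hx W hW
  refine h1.trans ?_
  exact le_csSup ((T.finite_toSet.image _).bddAbove) ⟨j, hj, rfl⟩

lemma aux_beta_pos {K : ℕ} (b : Fin K × Finset (Fin K) → ℝ) (E : Finset (Fin K × Finset (Fin K)))
    (hE : ∀ W ∈ E, 0 < b W)
    (T : Finset (Fin K)) (hT : T.Nonempty) (hne : ∀ j ∈ T, (Lset E T j).Nonempty) :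
    0 < beta b E T := by
  obtain ⟨j, hj⟩ := hT
  obtain ⟨W, hW, hmin⟩ := Finset.exists_min_image (Lset E T j) b (hne j hj)
  have : 0 < b W := hE W (Finset.mem_filter.mp hW).1
  exact this.trans_le (aux_le_beta b E T j hj _ (hne j hj) hmin)

lemma aux_beta_le {K : ℕ} (b : Fin K × Finset (Fin K) → ℝ) (E : Finset (Fin K × Finset (Fin K)))
    (T : Finset (Fin K)) (hT : T.Nonempty) (x : ℝ)
    (h : ∀ j ∈ T, ∃ W ∈ Lset E T j, b W ≤ x) : beta b E T ≤ x := by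
  unfold beta
  apply csSup_le
  · exact (Finset.coe_nonempty.mpr hT).image _
  · rintro _ ⟨j, hj, rfl⟩
    obtain ⟨W, hW, hx⟩ := h j hj
    exact (csInf_le (((Lset E T j).finite_toSet.image b).bddBelow) ⟨W, hW, rfl⟩).trans hx

lemma aux_harm (a d : ℕ) : (harmonic a : ℝ) + (d : ℝ) / ((a + d : ℕ) : ℝ) ≤ harmonic (a + d) := by
  have key : ∀ N : ℕ, a + d ≤ N → (harmonic a : ℝ) + (d : ℝ) / (N : ℝ) ≤ harmonic (a + d) := by
    induction d with
    | zero => intro N _; simp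
    | succ d ih =>
      intro N hN
      have h1 := ih N (by omega)
      have h2 : (1 : ℝ) / (N : ℝ) ≤ ((a + d + 1 : ℕ) : ℝ)⁻¹ := by
        rw [one_div]
        apply inv_anti₀
        · positivity
        · exact_mod_cast hN
      rw [← Nat.add_assoc, harmonic_succ]
      push_cast at h2 ⊢
      rw [add_div]
      linarith
  exact key _ le_rfl

lemma aux_inj {K : ℕ} (Q : Finset (Fin K × Finset (Fin K))) (hQ : Feasible Q) :
    Set.InjOn Prod.fst (Q : Set (Fin K × Finset (Fin K))) := by
  intro p hp q hq h
  by_contra hne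
  exact (hQ p hp q hq hne).1 h

/-- The key greedy inequality. -/
lemma aux_price {K : ℕ} (b : Fin K × Finset (Fin K) → ℝ) (E R : Finset (Fin K × Finset (Fin K)))
    (hE : ∀ W ∈ E, 0 < b W) (hRE : R ⊆ E) (hR : Feasible R) (hRne : R.Nonempty) (x r : ℝ)
    (hx : ∀ W ∈ R, b W ≤ x)
    (hmax : ∀ T' : Finset (Fin K),
      T'.Nonempty → T' ⊆ Mset E → (∀ j ∈ T', (Lset E T' j).Nonempty) →
      (T'.card : ℝ) / beta b E T' ≤ r) : (R.card : ℝ) / x ≤ r := by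
  have hmem : ∀ W ∈ R, W ∈ Lset E (R.image Prod.fst) W.1 := by
    intro W hW
    refine Finset.mem_filter.mpr ⟨hRE hW, rfl, ?_⟩
    intro k hk
    obtain ⟨hk1, hk2⟩ := Finset.mem_erase.mp hk
    obtain ⟨U, hU, rfl⟩ := Finset.mem_image.mp hk2
    exact (hR W hW U hU (fun h => hk1 (by rw [h]))).2.2
  have hne : ∀ j ∈ R.image Prod.fst, (Lset E (R.image Prod.fst) j).Nonempty := by
    intro j hj
    obtain ⟨U, hU, rfl⟩ := Finset.mem_image.mp hj
    exact ⟨U, hmem U hU⟩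
  have h := hmax (R.image Prod.fst) (hRne.image _) (Finset.image_subset_image hRE) hne
  rw [Finset.card_image_of_injOn (aux_inj R hR)] at h
  refine le_trans ?_ h
  have hpos := aux_beta_pos b E hE (R.image Prod.fst) (hRne.image _) hne
  have hle : beta b E (R.image Prod.fst) ≤ x := by
    apply aux_beta_le _ _ _ (hRne.image _)
    intro j hj
    obtain ⟨U, hU, rfl⟩ := Finset.mem_image.mp hj
    exact ⟨U, hmem U hU, hx U hU⟩
  exact div_le_div_of_nonneg_left (by positivity) hpos hle

/-- Guarantee of the Size-Aware Coded Multicast (SACM) algorithm: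
greedily choosing an admissible `T` maximizing `|T| / β_T` and transmitting, for each
`j ∈ T`, a size-minimizing element of `L_{j,T}`, produces a clique cover of `𝒲` whose
cost is within a factor `1 + log K` of the optimum. -/
theorem stmt2 {K : ℕ} (hK : 1 ≤ K) (b : Fin K × Finset (Fin K) → ℝ)
    (hb : ∀ W : Fin K × Finset (Fin K), W.1 ∉ W.2 → 0 < b W)
    (Ws : Finset (Fin K × Finset (Fin K))) (hWs : ∀ W ∈ Ws, W.1 ∉ W.2)
    (m : ℕ) (P E : ℕ → Finset (Fin K × Finset (Fin K)))
    (T : ℕ → Finset (Fin K)) (V : ℕ → Fin K → Fin K × Finset (Fin K))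
    (hE1 : E 1 = Ws)
    (hEstep : ∀ i ∈ Finset.Icc 1 m, E (i + 1) = E i \ P i)
    (hEnd : E (m + 1) = ∅)
    (hTadm : ∀ i ∈ Finset.Icc 1 m, (T i).Nonempty ∧ T i ⊆ Mset (E i) ∧
      ∀ j ∈ T i, (Lset (E i) (T i) j).Nonempty)
    (hTmax : ∀ i ∈ Finset.Icc 1 m, ∀ T' : Finset (Fin K),
      T'.Nonempty → T' ⊆ Mset (E i) → (∀ j ∈ T', (Lset (E i) T' j).Nonempty) →
      (T'.card : ℝ) / beta b (E i) T' ≤ ((T i).card : ℝ) / beta b (E i) (T i))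
    (hV : ∀ i ∈ Finset.Icc 1 m, ∀ j ∈ T i,
      V i j ∈ Lset (E i) (T i) j ∧ ∀ W ∈ Lset (E i) (T i) j, b (V i j) ≤ b W)
    (hP : ∀ i ∈ Finset.Icc 1 m, P i = (T i).image (V i)) :
    (∀ i ∈ Finset.Icc 1 m, (P i).Nonempty ∧ Feasible (P i) ∧ P i ⊆ E i) ∧
    IsCover Ws ((Finset.Icc 1 m).image P) ∧
    ∑ i ∈ Finset.Icc 1 m, psize b (P i) ≤ (1 + Real.log K) * OPT b Ws := by
  have hVj : ∀ i ∈ Finset.Icc 1 m, ∀ j ∈ T i, V i j ∈ E i ∧ (V i j).1 = j ∧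
      (T i).erase j ⊆ (V i j).2 := fun i hi j hj => Finset.mem_filter.mp (hV i hi j hj).1
  have h1 : ∀ i ∈ Finset.Icc 1 m, (P i).Nonempty ∧ Feasible (P i) ∧ P i ⊆ E i := by
    intro i hi
    rw [hP i hi]
    refine ⟨(hTadm i hi).1.image _, ?_, ?_⟩
    · intro p hp q hq hpq
      obtain ⟨j, hj, rfl⟩ := Finset.mem_image.mp hp
      obtain ⟨l, hl, rfl⟩ := Finset.mem_image.mp hq
      have hjl : j ≠ l := fun h => hpq (by rw [h])
      obtain ⟨_, a2, a3⟩ := hVj i hi j hj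
      obtain ⟨_, c2, c3⟩ := hVj i hi l hl
      rw [a2, c2]
      exact ⟨hjl, c3 (Finset.mem_erase.mpr ⟨hjl, hj⟩), a3 (Finset.mem_erase.mpr ⟨hjl.symm, hl⟩)⟩
    · intro p hp
      obtain ⟨j, hj, rfl⟩ := Finset.mem_image.mp hp
      exact (hVj i hi j hj).1
  have hEsub : ∀ n, n ≤ m → E (n + 1) ⊆ Ws := by
    intro n
    induction n with
    | zero => intro _; rw [hE1]
    | succ n ih =>
      intro hn
      rw [hEstep (n + 1) (Finset.mem_Icc.mpr ⟨by omega, hn⟩)]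
      exact Finset.sdiff_subset.trans (ih (by omega))
  have hEsub2 : ∀ i ∈ Finset.Icc 1 m, E i ⊆ Ws := by
    intro i hi
    obtain ⟨h, h'⟩ := Finset.mem_Icc.mp hi
    have := hEsub (i - 1) (by omega)
    rwa [Nat.sub_add_cancel h] at this
  have hcov : ∀ n, n ≤ m → ∀ W ∈ Ws, W ∈ E (n + 1) ∨ ∃ i ∈ Finset.Icc 1 n, W ∈ P i := by
    intro n
    induction n with
    | zero => intro _ W hW; left; rw [hE1]; exact hW
    | succ n ih =>
      intro hn W hW
      rcases ih (by omega) W hW with h | ⟨i, hi, h⟩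
      · by_cases hWP : W ∈ P (n + 1)
        · exact Or.inr ⟨n + 1, Finset.mem_Icc.mpr ⟨by omega, le_rfl⟩, hWP⟩
        · left
          rw [hEstep (n + 1) (Finset.mem_Icc.mpr ⟨by omega, hn⟩)]
          exact Finset.mem_sdiff.mpr ⟨h, hWP⟩
      · exact Or.inr ⟨i, Finset.mem_Icc.mpr ⟨(Finset.mem_Icc.mp hi).1,
          by have := (Finset.mem_Icc.mp hi).2; omega⟩, h⟩
  have h2 : IsCover Ws ((Finset.Icc 1 m).image P) := by
    constructor
    · intro Q hQ
      obtain ⟨i, hi, rfl⟩ := Finset.mem_image.mp hQ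
      obtain ⟨a, c, d⟩ := h1 i hi
      exact ⟨a, c, d.trans (hEsub2 i hi)⟩
    · ext W
      simp only [Finset.mem_biUnion, Finset.mem_image, id]
      constructor
      · rintro ⟨_, ⟨i, hi, rfl⟩, hW⟩
        exact hEsub2 i hi ((h1 i hi).2.2 hW)
      · intro hW
        rcases hcov m le_rfl W hW with h | ⟨i, hi, h⟩
        · rw [hEnd] at h; simp at h
        · exact ⟨P i, ⟨i, hi, rfl⟩, h⟩
  refine ⟨h1, h2, ?_⟩
  have hlog : 0 ≤ Real.log K := Real.log_natCast_nonneg K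
  have hbW : ∀ W ∈ Ws, 0 < b W := fun W hW => hb W (hWs W hW)
  have hbE : ∀ i ∈ Finset.Icc 1 m, ∀ W ∈ E i, 0 < b W :=
    fun i hi W hW => hbW W (hEsub2 i hi hW)
  have hcard : ∀ i ∈ Finset.Icc 1 m, (P i).card = (T i).card := by
    intro i hi
    rw [hP i hi]
    apply Finset.card_image_of_injOn
    intro j hj l hl h
    rw [← (hVj i hi j hj).2.1, ← (hVj i hi l hl).2.1]
    exact congrArg Prod.fst h
  have hbetapos : ∀ i ∈ Finset.Icc 1 m, 0 < beta b (E i) (T i) := fun i hi =>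
    aux_beta_pos b _ (hbE i hi) _ (hTadm i hi).1 (hTadm i hi).2.2
  have hpsb : ∀ i ∈ Finset.Icc 1 m, psize b (P i) ≤ beta b (E i) (T i) := by
    intro i hi
    unfold psize
    apply csSup_le
    · exact (Finset.coe_nonempty.mpr (h1 i hi).1).image b
    · rintro _ ⟨W, hW, rfl⟩
      rw [hP i hi] at hW
      obtain ⟨j, hj, rfl⟩ := Finset.mem_image.mp hW
      exact aux_le_beta b _ _ j hj _ ((hTadm i hi).2.2 j hj) (hV i hi j hj).2
  have hpsizepos : ∀ Q : Finset (Fin K × Finset (Fin K)), Q.Nonempty → Q ⊆ Ws →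
      0 < psize b Q := by
    rintro Q ⟨W, hW⟩ hQ
    exact (hbW W (hQ hW)).trans_le (aux_le_psize b Q W hW)
  have hcpos : ∀ i ∈ Finset.Icc 1 m, (0 : ℝ) < ((P i).card : ℝ) := fun i hi => by
    exact_mod_cast Finset.card_pos.mpr (h1 i hi).1
  -- per-clique bound
  have hQ : ∀ Q : Finset (Fin K × Finset (Fin K)), Q.Nonempty → Feasible Q → Q ⊆ Ws →
      ∀ n, n ≤ m → ∑ i ∈ Finset.Icc 1 n, ((Q ∩ P i).card : ℝ) * (psize b (P i) / (P i).card)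
        + psize b Q * (harmonic (Q ∩ E (n + 1)).card : ℝ) ≤ psize b Q * (harmonic Q.card : ℝ) := by
    intro Q hQne hQf hQW n
    have hq := hpsizepos Q hQne hQW
    induction n with
    | zero =>
      intro _
      rw [hE1, Finset.inter_eq_left.mpr hQW]
      simp
    | succ n ih =>
      intro hn
      have hi : n + 1 ∈ Finset.Icc 1 m := Finset.mem_Icc.mpr ⟨by omega, hn⟩
      refine le_trans ?_ (ih (by omega))
      rw [Finset.sum_Icc_succ_top (by omega), add_assoc]
      refine add_le_add le_rfl ?_
      have hc : (Q ∩ E (n + 1)).card = (Q ∩ E (n + 1 + 1)).card + (Q ∩ P (n + 1)).card := by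
        rw [hEstep _ hi, ← Finset.card_union_of_disjoint]
        · congr 1
          ext W
          have := @(h1 _ hi).2.2 W
          simp only [Finset.mem_inter, Finset.mem_union, Finset.mem_sdiff]
          tauto
        · rw [Finset.disjoint_left]
          intro W h h'
          simp only [Finset.mem_inter, Finset.mem_sdiff] at h h'
          exact h.2.2 h'.2
      rcases (Q ∩ E (n + 1)).eq_empty_or_nonempty with hemp | hRne
      · rw [hemp, Finset.card_empty] at hc
        have e1 : (Q ∩ E (n + 1 + 1)).card = 0 := by omega
        have e2 : (Q ∩ P (n + 1)).card = 0 := by omega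
        rw [e1, e2, hemp]
        simp
      · have hpr := aux_price b (E (n + 1)) (Q ∩ E (n + 1)) (hbE _ hi) Finset.inter_subset_right
          (fun p hp q hq => hQf p (Finset.mem_inter.mp hp).1 q (Finset.mem_inter.mp hq).1) hRne
          (psize b Q) _ (fun W hW => aux_le_psize b Q W (Finset.mem_inter.mp hW).1) (hTmax _ hi)
        have hRpos : (0 : ℝ) < ((Q ∩ E (n + 1)).card : ℝ) := by
          exact_mod_cast Finset.card_pos.mpr hRne
        have hharm := aux_harm (Q ∩ E (n + 1 + 1)).card (Q ∩ P (n + 1)).card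
        rw [← hc] at hharm
        have hprice : psize b (P (n + 1)) / (P (n + 1)).card
            ≤ psize b Q / (Q ∩ E (n + 1)).card := by
          rw [← hcard _ hi] at hpr
          rw [div_le_div_iff₀ hq (hbetapos _ hi)] at hpr
          rw [div_le_div_iff₀ (hcpos _ hi) hRpos]
          have := mul_le_mul_of_nonneg_right (hpsb _ hi) hRpos.le
          linarith
        have s1 := mul_le_mul_of_nonneg_left hprice
          (Nat.cast_nonneg (α := ℝ) (Q ∩ P (n + 1)).card)
        have s2 := mul_le_mul_of_nonneg_left hharm hq.le
        have s3 : ((Q ∩ P (n + 1)).card : ℝ) * (psize b Q / (Q ∩ E (n + 1)).card)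
          = psize b Q * ((Q ∩ P (n + 1)).card / (Q ∩ E (n + 1)).card) := by ring
        linarith
  have hmain : ∀ C, IsCover Ws C →
      ∑ i ∈ Finset.Icc 1 m, psize b (P i) ≤ (1 + Real.log K) * cost b C := by
    intro C hC
    have hA : ∀ Q ∈ C, ∑ i ∈ Finset.Icc 1 m, ((Q ∩ P i).card : ℝ) * (psize b (P i) / (P i).card)
        ≤ (1 + Real.log K) * psize b Q := by
      intro Q hQC
      obtain ⟨q1, q2, q3⟩ := hC.1 Q hQC
      have h := hQ Q q1 q2 q3 m le_rfl
      rw [hEnd] at h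
      simp only [Finset.inter_empty, Finset.card_empty, harmonic_zero, Rat.cast_zero, mul_zero,
        add_zero] at h
      refine h.trans ?_
      rw [mul_comm]
      refine mul_le_mul_of_nonneg_right ?_ (hpsizepos Q q1 q3).le
      refine (harmonic_le_one_add_log _).trans ?_
      have hQK : Q.card ≤ K := by
        rw [← Finset.card_image_of_injOn (aux_inj Q q2)]
        simpa using Finset.card_le_univ (Q.image Prod.fst)
      have : (0 : ℝ) < (Q.card : ℝ) := by exact_mod_cast Finset.card_pos.mpr q1
      have := Real.log_le_log this (Nat.cast_le.mpr hQK)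
      linarith
    unfold cost
    rw [Finset.mul_sum]
    refine le_trans ?_ (Finset.sum_le_sum hA)
    rw [Finset.sum_comm]
    apply Finset.sum_le_sum
    intro i hi
    rw [← Finset.sum_mul]
    have hPW : P i ⊆ Ws := (h1 i hi).2.2.trans (hEsub2 i hi)
    have hle : ((P i).card : ℝ) ≤ ∑ Q ∈ C, ((Q ∩ P i).card : ℝ) := by
      have hsub : P i ⊆ C.biUnion (fun Q => Q ∩ P i) := by
        intro W hW
        have hW' := hPW hW
        rw [← hC.2] at hW'
        obtain ⟨Q, hQC, hWQ⟩ := Finset.mem_biUnion.mp hW'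
        exact Finset.mem_biUnion.mpr ⟨Q, hQC, Finset.mem_inter.mpr ⟨hWQ, hW⟩⟩
      exact_mod_cast (Finset.card_le_card hsub).trans Finset.card_biUnion_le
    have hnn : 0 ≤ psize b (P i) / (P i).card :=
      div_nonneg (hpsizepos _ (h1 i hi).1 hPW).le (hcpos i hi).le
    have := mul_le_mul_of_nonneg_right hle hnn
    rwa [mul_div_cancel₀ _ (hcpos i hi).ne'] at this
  have hpos : 0 < 1 + Real.log K := by linarith
  rw [← div_le_iff₀' hpos]
  unfold OPT
  apply le_csInf
  · exact ⟨_, _, h2, rfl⟩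
  · rintro _ ⟨C, hC, rfl⟩
    rw [div_le_iff₀' hpos]
    exact hmain C hC
end

section
/- Let E ⊆ 𝒲 and let T ⊆ M(E) be nonempty and admissible for E. Let Q_T(E) be the set of nonempty feasible packets P ⊆ E whose set of first coordinates equals T. Then Q_T(E) is nonempty and min_{P ∈ Q_T(E)} b(P) = β_T(E) = max_{j ∈ T} min_{(j,A) ∈ L_{j,T}(E)} b(j,A); moreover the packet R_T consisting of one size-minimizing element of L_{j,T}(E) for each j ∈ T attains this minimum. -/
open Finset

variable {α : Type*}

/-- For admissible nonempty `T ⊆ M(E)`, the class `Q_T(E)` is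
nonempty, its minimum packet size equals `β_T(E) = max_{j ∈ T} min_{W ∈ L_{j,T}(E)} b W`,
and the packet `R_T` built from one size-minimizing element of each `L_{j,T}(E)`
attains this minimum. -/
theorem stmt6 {K : ℕ} (hK : 1 ≤ K) (b : Fin K × Finset (Fin K) → ℝ)
    (hb : ∀ W : Fin K × Finset (Fin K), W.1 ∉ W.2 → 0 < b W)
    (Ws : Finset (Fin K × Finset (Fin K))) (hWs : ∀ W ∈ Ws, W.1 ∉ W.2)
    (E : Finset (Fin K × Finset (Fin K))) (hE : E ⊆ Ws)
    (T : Finset (Fin K)) (hTne : T.Nonempty) (hTM : T ⊆ Mset E)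
    (hTadm : ∀ j ∈ T, (Lset E T j).Nonempty)
    (V : Fin K → Fin K × Finset (Fin K))
    (hV : ∀ j ∈ T, V j ∈ Lset E T j ∧ ∀ W ∈ Lset E T j, b (V j) ≤ b W) :
    ((T.image V).Nonempty ∧ Feasible (T.image V) ∧ T.image V ⊆ E ∧
      (T.image V).image Prod.fst = T) ∧
    psize b (T.image V) = beta b E T ∧
    (∀ P : Finset (Fin K × Finset (Fin K)), P.Nonempty → Feasible P → P ⊆ E →
      P.image Prod.fst = T → beta b E T ≤ psize b P) := by
  have hmem : ∀ j ∈ T, V j ∈ E ∧ (V j).1 = j ∧ T.erase j ⊆ (V j).2 := by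
    intro j hj
    have h := (hV j hj).1
    simpa [Lset] using h
  have hinf : ∀ j ∈ T, sInf (b '' (↑(Lset E T j) : Set (Fin K × Finset (Fin K)))) = b (V j) := by
    intro j hj
    apply IsLeast.csInf_eq
    refine ⟨⟨V j, (hV j hj).1, rfl⟩, ?_⟩
    rintro _ ⟨W, hW, rfl⟩
    exact (hV j hj).2 W hW
  have hbeta : beta b E T = sSup ((fun j => b (V j)) '' (↑T : Set (Fin K))) := by
    unfold beta
    congr 1
    apply Set.image_congr
    intro j hj
    exact hinf j hj
  refine ⟨⟨hTne.image V, ?_, ?_, ?_⟩, ?_, ?_⟩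
  · intro p hp q hq hpq
    obtain ⟨i, hi, rfl⟩ := Finset.mem_image.1 hp
    obtain ⟨j, hj, rfl⟩ := Finset.mem_image.1 hq
    have hij : i ≠ j := fun h => hpq (by rw [h])
    obtain ⟨-, hi1, hi2⟩ := hmem i hi
    obtain ⟨-, hj1, hj2⟩ := hmem j hj
    rw [hi1, hj1]
    exact ⟨hij, hj2 (Finset.mem_erase.2 ⟨hij, hi⟩), hi2 (Finset.mem_erase.2 ⟨hij.symm, hj⟩)⟩
  · intro p hp
    obtain ⟨i, hi, rfl⟩ := Finset.mem_image.1 hp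
    exact (hmem i hi).1
  · ext j
    simp only [Finset.mem_image]
    constructor
    · rintro ⟨_, ⟨i, hi, rfl⟩, rfl⟩
      rw [(hmem i hi).2.1]
      exact hi
    · intro hj
      exact ⟨V j, ⟨j, hj, rfl⟩, (hmem j hj).2.1⟩
  · rw [hbeta, psize, Finset.coe_image, Set.image_image]
  · intro P hPne hPf hPE hPT
    rw [hbeta]
    apply csSup_le (hTne.to_set.image _)
    rintro _ ⟨j, hj, rfl⟩
    have hjT : j ∈ T := hj
    have hj' := hjT
    rw [← hPT] at hj'
    obtain ⟨W, hW, hWj⟩ := Finset.mem_image.1 hj'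
    have hWL : W ∈ Lset E T j := by
      refine Finset.mem_filter.2 ⟨hPE hW, hWj, ?_⟩
      intro i hi
      obtain ⟨hij, hiT⟩ := Finset.mem_erase.1 hi
      rw [← hPT] at hiT
      obtain ⟨U, hU, hUi⟩ := Finset.mem_image.1 hiT
      have hne : W ≠ U := by
        rintro rfl
        exact hij (hUi.symm.trans hWj)
      rw [← hUi]
      exact (hPf W hW U hU hne).2.2
    refine ((hV j hjT).2 W hWL).trans ?_
    exact le_csSup (P.finite_toSet.image b).bddAbove ⟨W, hW, rfl⟩
end

section
/- Fix K ≥ 1 and B > 0. Consider the instance 𝒲 = {(k, (Fin K) \ {k}) : k ∈ Fin K} in which every subfile has size B. Then: (i) 𝒲 itself is a feasible packet; (ii) OPT(𝒲) = B; and (iii) the cost of the uncoded delivery, namely Σ_{W ∈ 𝒲} b(W) = K·B, equals K · OPT(𝒲). Hence the approximation ratio of uncoded delivery on this instance is exactly K. -/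
open Finset

variable {α : Type*}

/-- On the instance `𝒲 = {(k, Fin K \ {k}) : k}` with all subfile
sizes equal to `B > 0`: `𝒲` is a feasible packet, `OPT(𝒲) = B`, and the cost of
uncoded delivery is `K·B = K · OPT(𝒲)`. -/
theorem stmt8 {K : ℕ} (hK : 1 ≤ K) (B : ℝ) (hB : 0 < B)
    (b : Fin K × Finset (Fin K) → ℝ)
    (hb : ∀ W ∈ Finset.univ.image (fun k : Fin K => (k, Finset.univ.erase k)), b W = B) :
    Feasible (Finset.univ.image fun k : Fin K => (k, Finset.univ.erase k)) ∧
    OPT b (Finset.univ.image fun k : Fin K => (k, Finset.univ.erase k)) = B ∧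
    ∑ W ∈ Finset.univ.image (fun k : Fin K => (k, Finset.univ.erase k)), b W = K * B ∧
    ∑ W ∈ Finset.univ.image (fun k : Fin K => (k, Finset.univ.erase k)), b W =
      K * OPT b (Finset.univ.image fun k : Fin K => (k, Finset.univ.erase k)) := by
  have hpsize : ∀ P : Finset (Fin K × Finset (Fin K)), P.Nonempty →
      P ⊆ Finset.univ.image (fun k : Fin K => (k, Finset.univ.erase k)) → psize b P = B := by
    intro P hne hP
    have h : b '' (P : Set (Fin K × Finset (Fin K))) = {B} := by
      ext x
      simp only [Set.mem_image, Set.mem_singleton_iff]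
      constructor
      · rintro ⟨w, hw, rfl⟩
        exact hb w (hP hw)
      · rintro rfl
        obtain ⟨w, hw⟩ := hne
        exact ⟨w, hw, hb w (hP hw)⟩
    unfold psize
    rw [h, csSup_singleton]
  have hF : Feasible (Finset.univ.image fun k : Fin K => (k, Finset.univ.erase k)) := by
    intro p hp q hq hpq
    simp only [Finset.mem_image, Finset.mem_univ, true_and] at hp hq
    obtain ⟨k, rfl⟩ := hp
    obtain ⟨l, rfl⟩ := hq
    have hkl : k ≠ l := fun h => hpq (by rw [h])
    exact ⟨hkl, by simp [hkl], by simp [hkl.symm]⟩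
  have hWne : (Finset.univ.image fun k : Fin K => (k, Finset.univ.erase k)).Nonempty :=
    ⟨_, Finset.mem_image_of_mem _ (Finset.mem_univ (⟨0, hK⟩ : Fin K))⟩
  have hO : OPT b (Finset.univ.image fun k : Fin K => (k, Finset.univ.erase k)) = B := by
    refine IsLeast.csInf_eq ⟨?_, ?_⟩
    · refine ⟨{Finset.univ.image fun k : Fin K => (k, Finset.univ.erase k)}, ⟨?_, ?_⟩, ?_⟩
      · intro P hP
        rw [Finset.mem_singleton] at hP
        subst hP
        exact ⟨hWne, hF, Finset.Subset.refl _⟩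
      · rw [Finset.singleton_biUnion, id]
      · rw [cost, Finset.sum_singleton, hpsize _ hWne (Finset.Subset.refl _)]
    · rintro c ⟨C, ⟨hC, hU⟩, rfl⟩
      obtain ⟨w, hw⟩ := hWne
      rw [← hU, Finset.mem_biUnion] at hw
      obtain ⟨P, hP, -⟩ := hw
      have h1 : psize b P = B := hpsize P (hC P hP).1 (hC P hP).2.2
      rw [cost, ← h1]
      refine Finset.single_le_sum (f := psize b) (fun Q hQ => ?_) hP
      rw [hpsize Q (hC Q hQ).1 (hC Q hQ).2.2]
      exact hB.le
  have hS : ∑ W ∈ Finset.univ.image (fun k : Fin K => (k, Finset.univ.erase k)), b W = K * B := by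
    rw [Finset.sum_congr rfl hb, Finset.sum_const, Finset.card_image_of_injective _
      (fun k l h => (Prod.mk.inj h).1), Finset.card_univ, Fintype.card_fin, nsmul_eq_mul]
  exact ⟨hF, hO, hS, by rw [hS, hO]⟩
end

section
/- Identify the users with {1, …, K}, let K ≥ 3, l* = ⌊(K+1)/2⌋, B > 0, and ε > 0 with (l* − 1)·ε ≤ B. Consider the instance 𝒲 = W' ∪ W'' where W' = {(l, {1,…,K−l+1} \ {l}) : 1 ≤ l ≤ l*} with every subfile of size B, and W'' = {(k, {1,…,K} \ {k}) : l* < k ≤ K} with every subfile of size ε. Let 𝒞 be the GCM cover of 𝒲, i.e. the family of nonempty sets C_S = {(k,A) ∈ 𝒲 : A ∪ {k} = S} over S ⊆ {1,…,K}. Then 𝒞 is a clique cover of 𝒲 whose cost equals l*·B, while {W', W''} is a clique cover of 𝒲 of cost B + ε, so OPT(𝒲) ≤ B + ε; consequently the cost of 𝒞 is at least (l* − 1) · OPT(𝒲) = ⌊(K−1)/2⌋ · OPT(𝒲). -/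
open Finset

variable {α : Type*}

/-- The packet `W'` of the instance for part 2 of Theorem 3 (the `l`-th subfile is
`(l, {1,…,K−l+1} \ {l})` for `1 ≤ l ≤ l* = ⌊(K+1)/2⌋`). -/
def Wp (K : ℕ) : Finset (ℕ × Finset ℕ) :=
  (Finset.Icc 1 ((K + 1) / 2)).image fun l => (l, (Finset.Icc 1 (K - l + 1)).erase l)

/-- The packet `W''` of the instance for part 2 of Theorem 3
(`(k, {1,…,K} \ {k})` for `l* < k ≤ K`). -/
def Wpp (K : ℕ) : Finset (ℕ × Finset ℕ) :=
  (Finset.Icc ((K + 1) / 2 + 1) K).image fun k => (k, (Finset.Icc 1 K).erase k)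

/-- The GCM cover of `Ws`: the family of nonempty packets
`C_S = {(k,A) ∈ Ws : A ∪ {k} = S}` for `S ⊆ {1,…,K}`. -/
def GCMcover (K : ℕ) (Ws : Finset (ℕ × Finset ℕ)) : Finset (Finset (ℕ × Finset ℕ)) :=
  (((Finset.Icc 1 K).powerset).image
    (fun S => Ws.filter fun W => insert W.1 W.2 = S)).filter fun C => C.Nonempty

theorem mem_Wp_iff {K : ℕ} {p : ℕ × Finset ℕ} : p ∈ Wp K ↔
    ∃ l, (1 ≤ l ∧ l ≤ (K + 1) / 2) ∧ (l, (Finset.Icc 1 (K - l + 1)).erase l) = p := by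
  simp [Wp]

theorem mem_Wpp_iff {K : ℕ} {p : ℕ × Finset ℕ} : p ∈ Wpp K ↔
    ∃ l, ((K + 1) / 2 + 1 ≤ l ∧ l ≤ K) ∧ (l, (Finset.Icc 1 K).erase l) = p := by
  simp [Wpp]

/-- Every subfile of the instance has support `{1,…,K-l+1}` for some `l ≤ l*`. -/
theorem support_eq {K : ℕ} (hK : 3 ≤ K) {p : ℕ × Finset ℕ} (hp : p ∈ Wp K ∪ Wpp K) :
    p.1 ∉ p.2 ∧ ∃ l ∈ Finset.Icc 1 ((K + 1) / 2),
      insert p.1 p.2 = Finset.Icc 1 (K - l + 1) := by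
  rcases Finset.mem_union.1 hp with h | h
  · obtain ⟨l, hl, rfl⟩ := mem_Wp_iff.1 h
    refine ⟨by simp, l, by simpa using hl, ?_⟩
    apply Finset.insert_erase
    simp only [Finset.mem_Icc]
    omega
  · obtain ⟨l, hl, rfl⟩ := mem_Wpp_iff.1 h
    refine ⟨by simp, 1, by simp only [Finset.mem_Icc]; omega, ?_⟩
    have : K - 1 + 1 = K := by omega
    rw [this]
    apply Finset.insert_erase
    simp only [Finset.mem_Icc]
    omega

/-- The packet of `l`. -/
def packetOf (K l : ℕ) : Finset (ℕ × Finset ℕ) :=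
  (Wp K ∪ Wpp K).filter fun W => insert W.1 W.2 = Finset.Icc 1 (K - l + 1)

theorem self_mem_packetOf {K l : ℕ} (hl : l ∈ Finset.Icc 1 ((K + 1) / 2)) :
    (l, (Finset.Icc 1 (K - l + 1)).erase l) ∈ packetOf K l := by
  rw [Finset.mem_Icc] at hl
  refine Finset.mem_filter.2 ⟨Finset.mem_union_left _ (mem_Wp_iff.2 ⟨l, hl, rfl⟩), ?_⟩
  apply Finset.insert_erase
  simp only [Finset.mem_Icc]
  omega

theorem gcm_eq {K : ℕ} (hK : 3 ≤ K) :
    GCMcover K (Wp K ∪ Wpp K) = (Finset.Icc 1 ((K + 1) / 2)).image (packetOf K) := by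
  ext C
  simp only [GCMcover, Finset.mem_filter, Finset.mem_image]
  constructor
  · rintro ⟨⟨S, -, rfl⟩, p, hp⟩
    obtain ⟨hp1, rfl⟩ := Finset.mem_filter.1 hp
    obtain ⟨-, l, hl, h⟩ := support_eq hK hp1
    exact ⟨l, hl, by rw [packetOf, h]⟩
  · rintro ⟨l, hl, rfl⟩
    refine ⟨⟨Finset.Icc 1 (K - l + 1), ?_, rfl⟩, _, self_mem_packetOf hl⟩
    rw [Finset.mem_Icc] at hl
    rw [Finset.mem_powerset]
    apply Finset.Icc_subset_Icc le_rfl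
    omega

theorem packetOf_inj {K : ℕ} :
    Set.InjOn (packetOf K) (Finset.Icc 1 ((K + 1) / 2) : Finset ℕ) := by
  intro l hl m hm h
  have hl' := self_mem_packetOf (Finset.mem_coe.1 hl)
  have h1 := (Finset.mem_filter.1 hl').2
  rw [h] at hl'
  have h2 := (Finset.mem_filter.1 hl').2
  rw [h1] at h2
  have h3 := congrArg Finset.card h2
  simp only [Nat.card_Icc] at h3
  simp only [Finset.coe_Icc, Set.mem_Icc] at hl hm
  omega

theorem feasible_packetOf {K : ℕ} (hK : 3 ≤ K) (l : ℕ) : Feasible (packetOf K l) := by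
  intro p hp q hq hpq
  obtain ⟨hp1, hp2⟩ := Finset.mem_filter.1 hp
  obtain ⟨hq1, hq2⟩ := Finset.mem_filter.1 hq
  have hp3 := (support_eq hK hp1).1
  have hq3 := (support_eq hK hq1).1
  have he := hp2.trans hq2.symm
  have hne : p.1 ≠ q.1 := by
    intro h
    apply hpq
    refine Prod.ext h ?_
    rw [← Finset.erase_insert hp3, ← Finset.erase_insert hq3, he, h]
  refine ⟨hne, ?_, ?_⟩
  · have : p.1 ∈ insert q.1 q.2 := he ▸ Finset.mem_insert_self _ _
    exact (Finset.mem_insert.1 this).resolve_left hne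
  · have : q.1 ∈ insert p.1 p.2 := he ▸ Finset.mem_insert_self _ _
    exact (Finset.mem_insert.1 this).resolve_left hne.symm

theorem psize_eq {b : ℕ × Finset ℕ → ℝ} {P : Finset (ℕ × Finset ℕ)} {c : ℝ}
    {p : ℕ × Finset ℕ} (hp : p ∈ P) (hc : b p = c) (h : ∀ q ∈ P, b q ≤ c) :
    psize b P = c := by
  apply IsGreatest.csSup_eq
  refine ⟨⟨p, hp, hc⟩, ?_⟩
  rintro _ ⟨q, hq, rfl⟩
  exact h q hq

/-- On the instance `𝒲 = W' ∪ W''` (sizes `B` on `W'`, `ε` on `W''`,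
with `(l*−1)·ε ≤ B`), the GCM cover is a clique cover of cost `l*·B`, while
`{W', W''}` is a clique cover of cost `B + ε`, so `OPT(𝒲) ≤ B + ε` and the cost of the
GCM cover is at least `(l*−1)·OPT(𝒲) = ⌊(K−1)/2⌋·OPT(𝒲)`. -/
theorem stmt10 (K : ℕ) (hK : 3 ≤ K) (B ε : ℝ) (hB : 0 < B) (hε : 0 < ε)
    (hεB : (((K + 1) / 2 - 1 : ℕ) : ℝ) * ε ≤ B)
    (b : ℕ × Finset ℕ → ℝ)
    (hb1 : ∀ W ∈ Wp K, b W = B) (hb2 : ∀ W ∈ Wpp K, b W = ε) :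
    IsCover (Wp K ∪ Wpp K) (GCMcover K (Wp K ∪ Wpp K)) ∧
    cost b (GCMcover K (Wp K ∪ Wpp K)) = (((K + 1) / 2 : ℕ) : ℝ) * B ∧
    IsCover (Wp K ∪ Wpp K) {Wp K, Wpp K} ∧
    cost b ({Wp K, Wpp K} : Finset (Finset (ℕ × Finset ℕ))) = B + ε ∧
    OPT b (Wp K ∪ Wpp K) ≤ B + ε ∧
    (((K - 1) / 2 : ℕ) : ℝ) * OPT b (Wp K ∪ Wpp K) ≤
      cost b (GCMcover K (Wp K ∪ Wpp K)) := by
  have h1p : (1, (Finset.Icc 1 (K - 1 + 1)).erase 1) ∈ Wp K :=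
    mem_Wp_iff.2 ⟨1, by omega, rfl⟩
  have hKp : (K, (Finset.Icc 1 K).erase K) ∈ Wpp K :=
    mem_Wpp_iff.2 ⟨K, by omega, rfl⟩
  have hεleB : ε ≤ B := by
    have : (1 : ℝ) ≤ (((K + 1) / 2 - 1 : ℕ) : ℝ) := by
      have : 1 ≤ (K + 1) / 2 - 1 := by omega
      exact_mod_cast this
    nlinarith
  have hle : ∀ W ∈ Wp K ∪ Wpp K, b W ≤ B := by
    intro W hW
    rcases Finset.mem_union.1 hW with h | h
    · exact (hb1 W h).le
    · exact (hb2 W h).le.trans hεleB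
  have hnn : ∀ W ∈ Wp K ∪ Wpp K, 0 ≤ b W := by
    intro W hW
    rcases Finset.mem_union.1 hW with h | h
    · rw [hb1 W h]; exact hB.le
    · rw [hb2 W h]; exact hε.le
  have hne : Wp K ≠ Wpp K := by
    intro h
    rw [h] at h1p
    obtain ⟨l, hl, he⟩ := mem_Wpp_iff.1 h1p
    have := congrArg Prod.fst he
    simp only at this
    omega
  have c1 : IsCover (Wp K ∪ Wpp K) (GCMcover K (Wp K ∪ Wpp K)) := by
    rw [gcm_eq hK]
    refine ⟨?_, ?_⟩
    · intro P hP
      obtain ⟨l, hl, rfl⟩ := Finset.mem_image.1 hP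
      exact ⟨⟨_, self_mem_packetOf hl⟩, feasible_packetOf hK l, Finset.filter_subset _ _⟩
    · ext p
      simp only [Finset.mem_biUnion, id]
      constructor
      · rintro ⟨P, hP, hp⟩
        obtain ⟨l, hl, rfl⟩ := Finset.mem_image.1 hP
        exact (Finset.mem_filter.1 hp).1
      · intro hp
        obtain ⟨-, l, hl, h⟩ := support_eq hK hp
        exact ⟨_, Finset.mem_image_of_mem _ hl, Finset.mem_filter.2 ⟨hp, h⟩⟩
  have c2 : cost b (GCMcover K (Wp K ∪ Wpp K)) = (((K + 1) / 2 : ℕ) : ℝ) * B := by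
    rw [gcm_eq hK, cost, Finset.sum_image packetOf_inj]
    have : ∀ l ∈ Finset.Icc 1 ((K + 1) / 2), psize b (packetOf K l) = B := by
      intro l hl
      refine psize_eq (self_mem_packetOf hl) (hb1 _ ?_) ?_
      · exact mem_Wp_iff.2 ⟨l, Finset.mem_Icc.1 hl, rfl⟩
      · intro q hq
        exact hle q (Finset.mem_filter.1 hq).1
    rw [Finset.sum_congr rfl this]
    simp
  have c3 : IsCover (Wp K ∪ Wpp K) {Wp K, Wpp K} := by
    refine ⟨?_, by simp⟩
    intro P hP
    rcases Finset.mem_insert.1 hP with rfl | hP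
    · refine ⟨⟨_, h1p⟩, ?_, Finset.subset_union_left⟩
      intro p hp q hq hpq
      obtain ⟨l, hl, rfl⟩ := mem_Wp_iff.1 hp
      obtain ⟨m, hm, rfl⟩ := mem_Wp_iff.1 hq
      have hlm : l ≠ m := by
        rintro rfl
        exact hpq rfl
      simp only [Finset.mem_erase, Finset.mem_Icc]
      omega
    · rw [Finset.mem_singleton] at hP
      subst hP
      refine ⟨⟨_, hKp⟩, ?_, Finset.subset_union_right⟩
      intro p hp q hq hpq
      obtain ⟨l, hl, rfl⟩ := mem_Wpp_iff.1 hp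
      obtain ⟨m, hm, rfl⟩ := mem_Wpp_iff.1 hq
      have hlm : l ≠ m := by
        rintro rfl
        exact hpq rfl
      simp only [Finset.mem_erase, Finset.mem_Icc]
      omega
  have c4 : cost b ({Wp K, Wpp K} : Finset (Finset (ℕ × Finset ℕ))) = B + ε := by
    rw [cost, Finset.sum_pair hne,
      psize_eq h1p (hb1 _ h1p) (fun q hq => (hb1 q hq).le),
      psize_eq hKp (hb2 _ hKp) (fun q hq => (hb2 q hq).le)]
  have c5 : OPT b (Wp K ∪ Wpp K) ≤ B + ε := by
    refine csInf_le ⟨0, ?_⟩ ⟨_, c3, c4.symm⟩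
    rintro c ⟨C, hC, rfl⟩
    refine Finset.sum_nonneg fun P hP => Real.sSup_nonneg ?_
    rintro _ ⟨q, hq, rfl⟩
    exact hnn q ((hC.1 P hP).2.2 hq)
  refine ⟨c1, c2, c3, c4, c5, ?_⟩
  rw [c2]
  obtain ⟨n, hn⟩ : ∃ n, (K + 1) / 2 = n + 1 := ⟨(K + 1) / 2 - 1, by omega⟩
  have hn2 : (K - 1) / 2 = n := by omega
  rw [hn] at hεB ⊢
  rw [hn2]
  simp only [Nat.add_sub_cancel] at hεB
  have := mul_le_mul_of_nonneg_left c5 (Nat.cast_nonneg (α := ℝ) n)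
  push_cast
  linarith
end

section
/- Identify the users with {1, …, K}, let K ≥ 3, B > 0, and ε > 0 with K·(K − 1)·ε ≤ B. Let σ(k) = k + 1 for k < K and σ(K) = 1. Consider the instance 𝒲 = W' ∪ W'' where W' = {(k, {1,…,K} \ {k}) : 1 ≤ k ≤ K} with every subfile of size B and W'' = {(k, {σ(k)}) : 1 ≤ k ≤ K} with every subfile of size ε. Then: (i) for each k, the pair P_k = {(k, {σ(k)}), (σ(k), {1,…,K} \ {σ(k)})} is a feasible packet of size B, and the family 𝒟 = {P_k : 1 ≤ k ≤ K} (the cover produced by the graph coloring-based coded multicast scheme) is a clique cover of 𝒲 of cost K·B; (ii) the family consisting of W' together with the K singletons {(k, {σ(k)})} is a clique cover of 𝒲 of cost B + K·ε, so OPT(𝒲) ≤ B + K·ε; consequently the cost of 𝒟 is at least (K − 1) · OPT(𝒲). -/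
open Finset

variable {α : Type*}

/-- The cyclic successor on `{1, …, K}`: `σ(k) = k + 1` for `k < K` and `σ(K) = 1`. -/
def sigma' (K k : ℕ) : ℕ := if k < K then k + 1 else 1

/-- `W' = {(k, {1,…,K} \ {k}) : 1 ≤ k ≤ K}`. -/
def W12a (K : ℕ) : Finset (ℕ × Finset ℕ) :=
  (Finset.Icc 1 K).image fun k => (k, (Finset.Icc 1 K).erase k)

/-- `W'' = {(k, {σ(k)}) : 1 ≤ k ≤ K}`. -/
def W12b (K : ℕ) : Finset (ℕ × Finset ℕ) :=
  (Finset.Icc 1 K).image fun k => (k, ({sigma' K k} : Finset ℕ))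

/-- The packet `P_k = {(k, {σ(k)}), (σ(k), {1,…,K} \ {σ(k)})}` chosen by GCCM. -/
def P12 (K k : ℕ) : Finset (ℕ × Finset ℕ) :=
  {(k, ({sigma' K k} : Finset ℕ)), (sigma' K k, (Finset.Icc 1 K).erase (sigma' K k))}

theorem psize_eq_of {b : ℕ × Finset ℕ → ℝ} {P : Finset (ℕ × Finset ℕ)} {c : ℝ}
    (h1 : ∃ p ∈ P, b p = c) (h2 : ∀ p ∈ P, b p ≤ c) : psize b P = c := by
  unfold psize
  apply IsGreatest.csSup_eq
  constructor
  · obtain ⟨p, hp, h⟩ := h1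
    exact ⟨p, hp, h⟩
  · rintro _ ⟨p, hp, rfl⟩
    exact h2 p hp

theorem sigma_mem {K k : ℕ} (hK : 3 ≤ K) (hk : k ∈ Finset.Icc 1 K) :
    sigma' K k ∈ Finset.Icc 1 K := by
  simp only [Finset.mem_Icc] at *
  unfold sigma'
  split_ifs <;> omega

theorem sigma_ne {K k : ℕ} (hK : 3 ≤ K) : sigma' K k ≠ k := by
  unfold sigma'
  split_ifs <;> omega

theorem sigma_surj {K k : ℕ} (hK : 3 ≤ K) (hk : k ∈ Finset.Icc 1 K) :
    ∃ l ∈ Finset.Icc 1 K, sigma' K l = k := by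
  simp only [Finset.mem_Icc] at *
  by_cases h : k = 1
  · refine ⟨K, by omega, ?_⟩
    simp [sigma', h]
  · refine ⟨k - 1, by omega, ?_⟩
    unfold sigma'
    split_ifs <;> omega

theorem single_ne_erase {K a m : ℕ} (hK : 3 ≤ K) (hm : m ∈ Finset.Icc 1 K) :
    ({a} : Finset ℕ) ≠ (Finset.Icc 1 K).erase m := by
  intro h
  have := congrArg Finset.card h
  rw [Finset.card_erase_of_mem hm] at this
  simp at this
  omega

theorem mem_a {K k : ℕ} (hk : k ∈ Finset.Icc 1 K) :
    (k, (Finset.Icc 1 K).erase k) ∈ W12a K :=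
  Finset.mem_image.2 ⟨k, hk, rfl⟩

theorem mem_b {K k : ℕ} (hk : k ∈ Finset.Icc 1 K) :
    (k, ({sigma' K k} : Finset ℕ)) ∈ W12b K :=
  Finset.mem_image.2 ⟨k, hk, rfl⟩

theorem feas_P {K k : ℕ} (hK : 3 ≤ K) (hk : k ∈ Finset.Icc 1 K) : Feasible (P12 K k) := by
  have hs := sigma_ne (k := k) hK
  intro p hp q hq hpq
  simp only [P12, Finset.mem_insert, Finset.mem_singleton] at hp hq
  rcases hp with rfl | rfl <;> rcases hq with rfl | rfl
  · exact absurd rfl hpq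
  · exact ⟨hs.symm, Finset.mem_erase.2 ⟨hs.symm, hk⟩, Finset.mem_singleton_self _⟩
  · exact ⟨hs, Finset.mem_singleton_self _, Finset.mem_erase.2 ⟨hs.symm, hk⟩⟩
  · exact absurd rfl hpq

theorem inj_P {K : ℕ} (hK : 3 ≤ K) : Set.InjOn (P12 K) (Finset.Icc 1 K : Finset ℕ) := by
  intro k _ l hl h
  have hl' := sigma_mem hK (Finset.mem_coe.1 hl)
  have h1 : (k, ({sigma' K k} : Finset ℕ)) ∈ P12 K l := by
    rw [← h]; simp [P12]
  simp only [P12, Finset.mem_insert, Finset.mem_singleton, Prod.mk.injEq] at h1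
  rcases h1 with h1 | h1
  · exact h1.1
  · exact absurd h1.2 (single_ne_erase hK hl')

theorem feas_a (K : ℕ) : Feasible (W12a K) := by
  intro p hp q hq hpq
  obtain ⟨k, hk, rfl⟩ := Finset.mem_image.1 hp
  obtain ⟨l, hl, rfl⟩ := Finset.mem_image.1 hq
  have hkl : k ≠ l := by
    rintro rfl
    exact hpq rfl
  exact ⟨hkl, Finset.mem_erase.2 ⟨hkl, hk⟩, Finset.mem_erase.2 ⟨hkl.symm, hl⟩⟩

/-- On the instance `𝒲 = W' ∪ W''` (sizes `B` on `W'`, `ε` on `W''`,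
with `K·(K−1)·ε ≤ B`): each `P_k` is a feasible packet of size `B` and the GCCM family
`{P_k : 1 ≤ k ≤ K}` is a clique cover of cost `K·B`; while `W'` together with the `K`
singletons `{(k, {σ(k)})}` forms a clique cover of cost `B + K·ε`, so
`OPT(𝒲) ≤ B + K·ε` and the GCCM cost is at least `(K−1)·OPT(𝒲)`. -/
theorem stmt12 (K : ℕ) (hK : 3 ≤ K) (B ε : ℝ) (hB : 0 < B) (hε : 0 < ε)
    (hεB : (K : ℝ) * ((K : ℝ) - 1) * ε ≤ B)
    (b : ℕ × Finset ℕ → ℝ)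
    (hb1 : ∀ W ∈ W12a K, b W = B) (hb2 : ∀ W ∈ W12b K, b W = ε) :
    (∀ k ∈ Finset.Icc 1 K, Feasible (P12 K k) ∧ psize b (P12 K k) = B) ∧
    IsCover (W12a K ∪ W12b K) ((Finset.Icc 1 K).image (P12 K)) ∧
    cost b ((Finset.Icc 1 K).image (P12 K)) = (K : ℝ) * B ∧
    IsCover (W12a K ∪ W12b K) (insert (W12a K)
      ((Finset.Icc 1 K).image fun k => ({(k, ({sigma' K k} : Finset ℕ))} :
        Finset (ℕ × Finset ℕ)))) ∧
    cost b (insert (W12a K)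
      ((Finset.Icc 1 K).image fun k => ({(k, ({sigma' K k} : Finset ℕ))} :
        Finset (ℕ × Finset ℕ)))) = B + (K : ℝ) * ε ∧
    OPT b (W12a K ∪ W12b K) ≤ B + (K : ℝ) * ε ∧
    ((K : ℝ) - 1) * OPT b (W12a K ∪ W12b K) ≤
      cost b ((Finset.Icc 1 K).image (P12 K)) := by
  have hK' : (3 : ℝ) ≤ K := by exact_mod_cast hK
  have hεB' : ε ≤ B := by nlinarith [mul_pos (show (0:ℝ) < K by linarith) hε]
  have h1K : 1 ∈ Finset.Icc 1 K := by simp; omega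
  have hP : ∀ k ∈ Finset.Icc 1 K, psize b (P12 K k) = B := by
    intro k hk
    have e1 := hb1 _ (mem_a (sigma_mem hK hk))
    have e2 := hb2 _ (mem_b hk)
    apply psize_eq_of
    · exact ⟨_, by simp [P12], e1⟩
    · intro p hp
      simp only [P12, Finset.mem_insert, Finset.mem_singleton] at hp
      rcases hp with rfl | rfl
      · rw [e2]; exact hεB'
      · rw [e1]
  have hA : psize b (W12a K) = B :=
    psize_eq_of ⟨_, mem_a h1K, hb1 _ (mem_a h1K)⟩ fun p hp => (hb1 p hp).le
  have hS : ∀ k ∈ Finset.Icc 1 K,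
      psize b ({(k, ({sigma' K k} : Finset ℕ))} : Finset (ℕ × Finset ℕ)) = ε := by
    intro k hk
    have e2 := hb2 _ (mem_b hk)
    apply psize_eq_of
    · exact ⟨_, Finset.mem_singleton_self _, e2⟩
    · intro p hp
      rw [Finset.mem_singleton.1 hp, e2]
  have hcost1 : cost b ((Finset.Icc 1 K).image (P12 K)) = (K : ℝ) * B := by
    unfold cost
    rw [Finset.sum_image (inj_P hK), Finset.sum_congr rfl hP]
    simp
  have hcov1 : IsCover (W12a K ∪ W12b K) ((Finset.Icc 1 K).image (P12 K)) := by
    refine ⟨?_, ?_⟩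
    · intro P hP
      obtain ⟨k, hk, rfl⟩ := Finset.mem_image.1 hP
      refine ⟨⟨_, Finset.mem_insert_self _ _⟩, feas_P hK hk, ?_⟩
      intro p hp
      simp only [P12, Finset.mem_insert, Finset.mem_singleton] at hp
      rcases hp with rfl | rfl
      · exact Finset.mem_union_right _ (mem_b hk)
      · exact Finset.mem_union_left _ (mem_a (sigma_mem hK hk))
    · apply Finset.Subset.antisymm
      · intro p hp
        obtain ⟨P, hP, hp⟩ := Finset.mem_biUnion.1 hp
        obtain ⟨k, hk, rfl⟩ := Finset.mem_image.1 hP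
        simp only [id, P12, Finset.mem_insert, Finset.mem_singleton] at hp
        rcases hp with rfl | rfl
        · exact Finset.mem_union_right _ (mem_b hk)
        · exact Finset.mem_union_left _ (mem_a (sigma_mem hK hk))
      · intro p hp
        rcases Finset.mem_union.1 hp with hp | hp
        · obtain ⟨k, hk, rfl⟩ := Finset.mem_image.1 hp
          obtain ⟨l, hl, rfl⟩ := sigma_surj hK hk
          exact Finset.mem_biUnion.2 ⟨P12 K l, Finset.mem_image_of_mem _ hl, by simp [P12]⟩
        · obtain ⟨k, hk, rfl⟩ := Finset.mem_image.1 hp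
          exact Finset.mem_biUnion.2 ⟨P12 K k, Finset.mem_image_of_mem _ hk, by simp [P12]⟩
  have hcov2 : IsCover (W12a K ∪ W12b K) (insert (W12a K)
      ((Finset.Icc 1 K).image fun k => ({(k, ({sigma' K k} : Finset ℕ))} :
        Finset (ℕ × Finset ℕ)))) := by
    have key : ∀ P ∈ (insert (W12a K)
      ((Finset.Icc 1 K).image fun k => ({(k, ({sigma' K k} : Finset ℕ))} :
        Finset (ℕ × Finset ℕ)))), P.Nonempty ∧ Feasible P ∧ P ⊆ W12a K ∪ W12b K := by
      intro P hP
      rcases Finset.mem_insert.1 hP with rfl | hP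
      · exact ⟨⟨_, mem_a h1K⟩, feas_a K, Finset.subset_union_left⟩
      · obtain ⟨k, hk, rfl⟩ := Finset.mem_image.1 hP
        refine ⟨Finset.singleton_nonempty _, ?_, ?_⟩
        · intro p hp q hq hpq
          rw [Finset.mem_singleton] at hp hq
          exact absurd (hp.trans hq.symm) hpq
        · exact Finset.singleton_subset_iff.2 (Finset.mem_union_right _ (mem_b hk))
    refine ⟨key, ?_⟩
    apply Finset.Subset.antisymm
    · exact Finset.biUnion_subset.2 fun P hP => (key P hP).2.2
    · intro p hp
      rcases Finset.mem_union.1 hp with hp | hp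
      · exact Finset.mem_biUnion.2 ⟨_, Finset.mem_insert_self _ _, hp⟩
      · obtain ⟨k, hk, rfl⟩ := Finset.mem_image.1 hp
        exact Finset.mem_biUnion.2 ⟨_, Finset.mem_insert_of_mem
          (Finset.mem_image.2 ⟨k, hk, rfl⟩), Finset.mem_singleton_self _⟩
  have hcost2 : cost b (insert (W12a K)
      ((Finset.Icc 1 K).image fun k => ({(k, ({sigma' K k} : Finset ℕ))} :
        Finset (ℕ × Finset ℕ)))) = B + (K : ℝ) * ε := by
    unfold cost
    rw [Finset.sum_insert, hA, Finset.sum_image, Finset.sum_congr rfl hS]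
    · simp
    · intro k _ l _ h
      have := Finset.singleton_injective h
      exact congrArg Prod.fst this
    · intro h
      obtain ⟨k, hk, h⟩ := Finset.mem_image.1 h
      have h1 := mem_a (sigma_mem hK hk)
      rw [← h, Finset.mem_singleton] at h1
      exact sigma_ne hK (congrArg Prod.fst h1)
  have hopt : OPT b (W12a K ∪ W12b K) ≤ B + (K : ℝ) * ε := by
    unfold OPT
    apply csInf_le
    · refine ⟨0, ?_⟩
      rintro c ⟨C, hC, rfl⟩
      unfold cost
      apply Finset.sum_nonneg
      intro P hP
      unfold psize
      apply Real.sSup_nonneg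
      rintro _ ⟨p, hp, rfl⟩
      rcases Finset.mem_union.1 ((hC.1 P hP).2.2 hp) with h | h
      · rw [hb1 p h]; exact hB.le
      · rw [hb2 p h]; exact hε.le
    · exact ⟨_, hcov2, hcost2.symm⟩
  refine ⟨fun k hk => ⟨feas_P hK hk, hP k hk⟩, hcov1, hcost1, hcov2, hcost2, hopt, ?_⟩
  rw [hcost1]
  have h := mul_le_mul_of_nonneg_left hopt (show (0:ℝ) ≤ (K:ℝ) - 1 by linarith)
  nlinarith
end

section
/- Let G be a simple graph on the vertex set Fin K, let A_k be the neighborhood of vertex k in G, and consider the instance 𝒲 = {(k, A_k) : k ∈ Fin K} in which every subfile has size 1. Then OPT(𝒲) equals the minimum number of cliques of G needed to cover all K vertices of G, i.e. the minimum cardinality of a family 𝒞 of cliques of G such that every vertex belongs to at least one member of 𝒞. (Hence the minimum clique cover problem is a special case of the optimal clique cover delivery problem.) -/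
open Finset

variable {α : Type*}

theorem cost_eq_card_of_cover {K : ℕ} (Ws : Finset (Fin K × Finset (Fin K)))
    (b : Fin K × Finset (Fin K) → ℝ) (hb : ∀ W ∈ Ws, b W = 1)
    (C : Finset (Finset (Fin K × Finset (Fin K)))) (hC : IsCover Ws C) :
    cost b C = C.card := by
  have h : ∀ P ∈ C, psize b P = 1 := by
    intro P hP
    obtain ⟨hne, -, hsub⟩ := hC.1 P hP
    have : b '' (↑P : Set (Fin K × Finset (Fin K))) = {1} := by
      ext x
      constructor
      · rintro ⟨W, hW, rfl⟩
        exact hb W (hsub hW)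
      · rintro rfl
        obtain ⟨W, hW⟩ := hne
        exact ⟨W, hW, hb W (hsub hW)⟩
    rw [psize, this, csSup_singleton]
  rw [cost, Finset.sum_congr rfl h]
  simp

theorem cover_of_cliques {K : ℕ} (G : SimpleGraph (Fin K)) [DecidableRel G.Adj]
    (C : Finset (Finset (Fin K))) (h1 : ∀ c ∈ C, G.IsClique ↑c)
    (h2 : ∀ v : Fin K, ∃ c ∈ C, v ∈ c) :
    ∃ D, IsCover (Finset.univ.image fun k : Fin K => (k, G.neighborFinset k)) D ∧
      D.card ≤ C.card := by
  refine ⟨(C.image (fun c => c.image fun k : Fin K => (k, G.neighborFinset k))).erase ∅,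
    ⟨?_, ?_⟩, (Finset.card_erase_le).trans Finset.card_image_le⟩
  · intro P hP
    rw [Finset.mem_erase, Finset.mem_image] at hP
    obtain ⟨hne, c, hc, rfl⟩ := hP
    refine ⟨Finset.nonempty_iff_ne_empty.2 hne, ?_,
      Finset.image_subset_image (Finset.subset_univ _)⟩
    intro p hp q hq hpq
    obtain ⟨k, hk, rfl⟩ := Finset.mem_image.1 hp
    obtain ⟨l, hl, rfl⟩ := Finset.mem_image.1 hq
    have hkl : k ≠ l := by
      rintro rfl
      exact hpq rfl
    have := h1 c hc hk hl hkl
    exact ⟨hkl, by simpa using this.symm, by simpa using this⟩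
  · ext W
    simp only [Finset.mem_biUnion, Finset.mem_erase, Finset.mem_image, id, Finset.mem_univ,
      true_and]
    constructor
    · rintro ⟨P, ⟨-, c, hc, rfl⟩, hW⟩
      obtain ⟨k, -, rfl⟩ := Finset.mem_image.1 hW
      exact ⟨k, rfl⟩
    · rintro ⟨k, rfl⟩
      obtain ⟨c, hc, hk⟩ := h2 k
      have hm : (k, G.neighborFinset k) ∈ c.image fun k : Fin K => (k, G.neighborFinset k) :=
        Finset.mem_image_of_mem _ hk
      exact ⟨_, ⟨Finset.ne_empty_of_mem hm, c, hc, rfl⟩, hm⟩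

theorem cliques_of_cover {K : ℕ} (G : SimpleGraph (Fin K)) [DecidableRel G.Adj]
    (D : Finset (Finset (Fin K × Finset (Fin K))))
    (hD : IsCover (Finset.univ.image fun k : Fin K => (k, G.neighborFinset k)) D) :
    ∃ C : Finset (Finset (Fin K)), (∀ c ∈ C, G.IsClique ↑c) ∧
      (∀ v : Fin K, ∃ c ∈ C, v ∈ c) ∧ C.card ≤ D.card := by
  refine ⟨D.image (fun P => P.image Prod.fst), ?_, ?_, Finset.card_image_le⟩
  · intro c hc
    obtain ⟨P, hP, rfl⟩ := Finset.mem_image.1 hc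
    obtain ⟨-, hf, hsub⟩ := hD.1 P hP
    intro k hk l hl hkl
    obtain ⟨p, hp, rfl⟩ := Finset.mem_image.1 (Finset.mem_coe.1 hk)
    obtain ⟨q, hq, rfl⟩ := Finset.mem_image.1 (Finset.mem_coe.1 hl)
    have h := (hf p hp q hq (fun h => hkl (by rw [h]))).2.2
    obtain ⟨k, -, rfl⟩ := Finset.mem_image.1 (hsub hp)
    simpa using h
  · intro v
    have hv : (v, G.neighborFinset v) ∈ D.biUnion id := by
      rw [hD.2]
      exact Finset.mem_image_of_mem _ (Finset.mem_univ v)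
    obtain ⟨P, hP, hvP⟩ := Finset.mem_biUnion.1 hv
    exact ⟨_, Finset.mem_image_of_mem _ hP, Finset.mem_image.2 ⟨_, hvP, rfl⟩⟩

/-- For the side-information instance built from a simple graph `G`
on `Fin K` (subfiles `(k, N(k))`, all of size `1`), the minimum cost `OPT(𝒲)` of a
clique cover delivery equals the minimum number of cliques of `G` needed to cover all
vertices of `G`. -/
theorem stmt14 {K : ℕ} (hK : 1 ≤ K) (G : SimpleGraph (Fin K)) [DecidableRel G.Adj]
    (b : Fin K × Finset (Fin K) → ℝ)
    (hb : ∀ W ∈ Finset.univ.image (fun k : Fin K => (k, G.neighborFinset k)), b W = 1) :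
    OPT b (Finset.univ.image fun k : Fin K => (k, G.neighborFinset k)) =
      ((sInf {n : ℕ | ∃ C : Finset (Finset (Fin K)),
        (∀ c ∈ C, G.IsClique ↑c) ∧ (∀ v : Fin K, ∃ c ∈ C, v ∈ c) ∧
        n = C.card} : ℕ) : ℝ) := by
  have hne : {n : ℕ | ∃ C : Finset (Finset (Fin K)),
        (∀ c ∈ C, G.IsClique ↑c) ∧ (∀ v : Fin K, ∃ c ∈ C, v ∈ c) ∧
        n = C.card}.Nonempty := by
    refine ⟨_, Finset.univ.image (fun k : Fin K => {k}), ?_, ?_, rfl⟩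
    · intro c hc
      obtain ⟨k, -, rfl⟩ := Finset.mem_image.1 hc
      simp
    · intro v
      exact ⟨{v}, Finset.mem_image_of_mem _ (Finset.mem_univ v), Finset.mem_singleton_self v⟩
  obtain ⟨C, h1, h2, h3⟩ := Nat.sInf_mem hne
  obtain ⟨D, hD, hDC⟩ := cover_of_cliques G C h1 h2
  unfold OPT
  apply le_antisymm
  · have hbdd : BddBelow {c : ℝ | ∃ C, IsCover (Finset.univ.image
        fun k : Fin K => (k, G.neighborFinset k)) C ∧ c = cost b C} := by
      refine ⟨0, ?_⟩
      rintro _ ⟨E, hE, rfl⟩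
      rw [cost_eq_card_of_cover _ b hb E hE]
      positivity
    refine (csInf_le hbdd ⟨D, hD, rfl⟩).trans ?_
    rw [cost_eq_card_of_cover _ b hb D hD, h3]
    exact_mod_cast hDC
  · refine le_csInf ⟨_, D, hD, rfl⟩ ?_
    rintro _ ⟨E, hE, rfl⟩
    rw [cost_eq_card_of_cover _ b hb E hE]
    obtain ⟨F, f1, f2, f3⟩ := cliques_of_cover G E hE
    refine Nat.cast_le.2 (le_trans (Nat.sInf_le ?_) f3)
    exact ⟨F, f1, f2, rfl⟩
end
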